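/- arXiv:2304.12073 — 2 statements merged into one kernel-verified Lean document; each statement's English description precedes it below -/
import Mathlib

section
/- Let K_{r_1,…,r_k} be a complete multipartite graph with k ≥ 3 parts, smallest part of size r_k = 2, no part of size exactly 3 (r_j ≠ 3 for all j), and an even total number of vertices n = r_1 + … + r_k. Then the game chromatic number satisfies χ_g(K_{r_1,…,r_k}) = 2k − 1. -/
/-- A color `c` is legal for vertex `v` in partial coloring `f` if no neighbor of `v`
is already colored with `c`. -/
def legalColor {V C : Type} (G : SimpleGraph V) (f : V → Option C) (v : V) (c : C) : Prop :=
  ∀ w, G.Adj v w → f w ≠ some c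

/-- A move in the coloring game: choose an uncolored vertex and color it with a legal color. -/
def gameMove {V C : Type} [DecidableEq V] (G : SimpleGraph V) (f f' : V → Option C) : Prop :=
  ∃ v c, f v = none ∧ legalColor G f v c ∧ f' = Function.update f v (some c)

/-- Every vertex is colored. -/
def isFull {V C : Type} (f : V → Option C) : Prop := ∀ v, (f v).isSome

/-- Some uncolored vertex has no legal color (then Bob wins). -/
def isStuck {V C : Type} (G : SimpleGraph V) (f : V → Option C) : Prop :=
  ∃ v, f v = none ∧ ∀ c, ¬ legalColor G f v c

/-- It is Alice's turn when an even number of vertices are colored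
(Alice moves first, and each move colors exactly one vertex). -/
def aliceTurn {V C : Type} [Fintype V] (f : V → Option C) : Prop :=
  Even (Finset.univ.filter (fun v => (f v).isSome = true)).card

/-- Alice has a winning strategy from position `f` when `n` vertices remain uncolored:
Alice wins exactly the plays in which the entire graph gets colored; as soon as some
uncolored vertex has no legal color, Bob wins. -/
def aliceWinsFrom {V C : Type} [Fintype V] [DecidableEq V] (G : SimpleGraph V) :
    ℕ → (V → Option C) → Prop
  | 0, f => isFull f
  | n + 1, f => isFull f ∨ (¬ isStuck G f ∧
      ((aliceTurn f ∧ ∃ f', gameMove G f f' ∧ aliceWinsFrom G n f') ∨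
       (¬ aliceTurn f ∧ ∀ f', gameMove G f f' → aliceWinsFrom G n f')))

/-- Alice has a winning strategy in the graph coloring game on `G` with `m` colors. -/
def aliceWins {V : Type} [Fintype V] [DecidableEq V] (G : SimpleGraph V) (m : ℕ) : Prop :=
  aliceWinsFrom (C := Fin m) G (Fintype.card V) (fun _ => none)

/-- The game chromatic number: the least number of colors for which Alice has
a winning strategy. -/
noncomputable def gameChromaticNumber {V : Type} [Fintype V] [DecidableEq V]
    (G : SimpleGraph V) : ℕ :=
  sInf {m | aliceWins G m}

/-- The complete multipartite graph `K_{r 0, …, r (k-1)}`. -/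
def K (k : ℕ) (r : Fin k → ℕ) : SimpleGraph (Σ i : Fin k, Fin (r i)) :=
  SimpleGraph.completeMultipartiteGraph (fun i => Fin (r i))

namespace MultipartiteGame

variable {k m : ℕ} {r : Fin k → ℕ}

/-- Partial colorings of `K k r` with `m` colors. -/
abbrev Position (k m : ℕ) (r : Fin k → ℕ) : Type := (Σ i : Fin k, Fin (r i)) → Option (Fin m)

/-- The colors that occur in a position. -/
def usedColors (f : Position k m r) : Finset (Fin m) :=
  Finset.univ.filter fun c => ∃ v, f v = some c

/-- The parts without a colored vertex. -/
def untouched (f : Position k m r) : Finset (Fin k) :=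
  Finset.univ.filter fun i => ∀ x, f ⟨i, x⟩ = none

/-- The uncolored vertices. -/
def uncolored (f : Position k m r) : Finset (Σ i : Fin k, Fin (r i)) :=
  Finset.univ.filter fun v => f v = none

/-- The uncolored vertices in parts that already have a colored vertex. -/
def openVertices (f : Position k m r) : Finset (Σ i : Fin k, Fin (r i)) :=
  (uncolored f).filter fun v => v.1 ∉ untouched f

@[simp] lemma mem_usedColors {f : Position k m r} {c : Fin m} :
    c ∈ usedColors f ↔ ∃ v, f v = some c := by simp [usedColors]

@[simp] lemma mem_untouched {f : Position k m r} {i : Fin k} :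
    i ∈ untouched f ↔ ∀ x, f ⟨i, x⟩ = none := by simp [untouched]

@[simp] lemma mem_uncolored {f : Position k m r} {v : Σ i : Fin k, Fin (r i)} :
    v ∈ uncolored f ↔ f v = none := by simp [uncolored]

lemma legalColor_iff {f : Position k m r} {v : Σ i : Fin k, Fin (r i)} {c : Fin m} :
    legalColor (K k r) f v c ↔ ∀ w, v.1 ≠ w.1 → f w ≠ some c := by
  simp [legalColor, K, SimpleGraph.completeMultipartiteGraph]

lemma legalColor_of_notMem_usedColors {f : Position k m r} {c : Fin m} (hc : c ∉ usedColors f)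
    (v : Σ i : Fin k, Fin (r i)) : legalColor (K k r) f v c :=
  fun w _ hw => hc (mem_usedColors.2 ⟨w, hw⟩)

lemma card_uncolored_eq (f : Position k m r) :
    (uncolored f).card = (openVertices f).card + ∑ i ∈ untouched f, r i := by
  have h : (uncolored f).filter (fun v => ¬ v.1 ∉ untouched f) =
      (untouched f).sigma fun i => (Finset.univ : Finset (Fin (r i))) := by
    ext ⟨i, x⟩
    simp only [Finset.mem_filter, mem_uncolored, not_not, Finset.mem_sigma, Finset.mem_univ,
      and_true, and_iff_right_iff_imp]
    exact fun h => mem_untouched.1 h x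
  rw [← Finset.card_filter_add_card_filter_not (s := uncolored f) (fun v => v.1 ∉ untouched f), h,
    Finset.card_sigma]
  simp [openVertices]

lemma card_colored_add_card_uncolored (f : Position k m r) :
    (Finset.univ.filter fun v => (f v).isSome = true).card + (uncolored f).card = ∑ i, r i := by
  have h : uncolored f = Finset.univ.filter fun v => ¬ (f v).isSome = true := by
    ext v; simp
  rw [h, Finset.card_filter_add_card_filter_not]
  simp

section Update

variable {f : Position k m r} {v : Σ i : Fin k, Fin (r i)} (hv : f v = none) (c : Fin m)
include hv

lemma usedColors_update :
    usedColors (Function.update f v (some c)) = insert c (usedColors f) := by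
  ext d
  simp only [mem_usedColors, Finset.mem_insert]
  constructor
  · rintro ⟨w, hw⟩
    by_cases h : w = v
    · subst h; simp at hw; exact Or.inl hw.symm
    · rw [Function.update_of_ne h] at hw; exact Or.inr ⟨w, hw⟩
  · rintro (rfl | ⟨w, hw⟩)
    · exact ⟨v, by simp⟩
    · refine ⟨w, ?_⟩
      rw [Function.update_of_ne (by rintro rfl; simp [hv] at hw), hw]

lemma uncolored_update : uncolored (Function.update f v (some c)) = (uncolored f).erase v := by
  ext w
  by_cases h : w = v
  · subst h; simp
  · simp [h]

lemma card_uncolored_update :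
    (uncolored (Function.update f v (some c))).card + 1 = (uncolored f).card := by
  rw [uncolored_update hv, Finset.card_erase_add_one (mem_uncolored.2 hv)]

lemma aliceTurn_update : aliceTurn (Function.update f v (some c)) ↔ ¬ aliceTurn f := by
  have h₁ := card_colored_add_card_uncolored f
  have h₂ := card_colored_add_card_uncolored (Function.update f v (some c))
  have h₃ := card_uncolored_update hv c
  unfold aliceTurn
  rw [← Nat.even_add_one]
  have : (Finset.univ.filter fun w => (Function.update f v (some c) w).isSome = true).card =
    (Finset.univ.filter fun w => (f w).isSome = true).card + 1 := by omega
  rw [this]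

omit hv in
lemma untouched_update :
    untouched (Function.update f v (some c)) = (untouched f).erase v.1 := by
  ext i
  simp only [mem_untouched, Finset.mem_erase]
  by_cases h : i = v.1
  · subst h
    simp only [ne_eq, not_true_eq_false, false_and, iff_false, not_forall]
    exact ⟨v.2, by simp⟩
  · simp only [ne_eq, h, not_false_eq_true, true_and]
    refine forall_congr' fun x => ?_
    rw [Function.update_of_ne]
    rintro rfl
    exact h rfl

lemma card_openVertices_update_of_notMem (h : v.1 ∉ untouched f) :
    (openVertices (Function.update f v (some c))).card + 1 = (openVertices f).card := by
  have h₁ := card_uncolored_eq f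
  have h₂ := card_uncolored_eq (Function.update f v (some c))
  have h₃ := card_uncolored_update hv c
  rw [untouched_update, Finset.erase_eq_of_notMem h] at h₂
  omega

lemma card_openVertices_update_of_mem (h : v.1 ∈ untouched f) :
    (openVertices (Function.update f v (some c))).card + 1 =
      (openVertices f).card + r v.1 := by
  have h₁ := card_uncolored_eq f
  have h₂ := card_uncolored_eq (Function.update f v (some c))
  have h₃ := card_uncolored_update hv c
  have h₄ := Finset.add_sum_erase _ r h
  rw [untouched_update] at h₂
  omega

end Update

lemma notMem_usedColors_of_legalColor {f : Position k m r} {v : Σ i : Fin k, Fin (r i)}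
    {c : Fin m} (h : v.1 ∈ untouched f) (hc : legalColor (K k r) f v c) : c ∉ usedColors f := by
  rw [legalColor_iff] at hc
  rw [mem_usedColors]
  rintro ⟨⟨i, x⟩, hw⟩
  by_cases hi : v.1 = i
  · subst hi
    simp [mem_untouched.1 h x] at hw
  · exact hc _ hi hw

lemma not_isFull_of_untouched {f : Position k m r} (hpos : ∀ i, 0 < r i)
    (hu : 0 < (untouched f).card) : ¬ isFull f := by
  obtain ⟨i, hi⟩ := Finset.card_pos.1 hu
  intro h
  have := h ⟨i, ⟨0, hpos i⟩⟩
  simp [mem_untouched.1 hi] at this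

lemma exists_notMem_usedColors {f : Position k m r} (hpos : ∀ i, 0 < r i)
    (hu : 0 < (untouched f).card) (hs : ¬ isStuck (K k r) f) : ∃ c, c ∉ usedColors f := by
  obtain ⟨i, hi⟩ := Finset.card_pos.1 hu
  by_contra! h
  exact hs ⟨⟨i, ⟨0, hpos i⟩⟩, mem_untouched.1 hi _,
    fun c hc => notMem_usedColors_of_legalColor hi hc (h c)⟩

/-- The condition that Bob maintains on Alice's turns. -/
structure BobInvariant (f : Position k m r) : Prop where
  turn : aliceTurn f
  slack : m + 2 ≤ 2 * (untouched f).card + (usedColors f).card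
  parity : Even (openVertices f).card ∨
    m + 3 ≤ 2 * (untouched f).card + (usedColors f).card ∨ 3 ≤ (openVertices f).card

lemma BobInvariant.untouched_pos {f : Position k m r} (hf : BobInvariant f) :
    0 < (untouched f).card := by
  have h₁ := hf.slack
  have h₂ := (usedColors f).card_le_univ
  rw [Fintype.card_fin] at h₂
  omega

/-- After any move of Alice, an untouched part remains, and unless Bob has already won he can
restore his invariant. -/
lemma BobInvariant.reply (htwo : ∀ i, 2 ≤ r i) (hne3 : ∀ i, r i ≠ 3) (heven : Even (∑ i, r i))
    {f f' : Position k m r} (hf : BobInvariant f) (hmove : gameMove (K k r) f f') :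
    ¬ aliceTurn f' ∧ 0 < (untouched f').card ∧
      (¬ isStuck (K k r) f' → ∃ f'', gameMove (K k r) f' f'' ∧ BobInvariant f'') := by
  have hpos : ∀ i, 0 < r i := fun i => by have := htwo i; omega
  obtain ⟨v, c, hv, hc, rfl⟩ := hmove
  have hturn : ¬ aliceTurn (Function.update f v (some c)) := by
    rw [aliceTurn_update hv, not_not]; exact hf.turn
  have hslack := hf.slack
  have hparity := hf.parity
  have key : (m + 1 ≤ 2 * (untouched (Function.update f v (some c))).card +
        (usedColors (Function.update f v (some c))).card) ∧
      ((0 < (openVertices (Function.update f v (some c))).card ∧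
        (Odd (openVertices (Function.update f v (some c))).card ∨
          m + 2 ≤ 2 * (untouched (Function.update f v (some c))).card +
            (usedColors (Function.update f v (some c))).card ∨
          4 ≤ (openVertices (Function.update f v (some c))).card)) ∨
      ((openVertices (Function.update f v (some c))).card = 0 ∧
        m + 3 ≤ 2 * (untouched (Function.update f v (some c))).card +
          (usedColors (Function.update f v (some c))).card)) := by
    rw [untouched_update, usedColors_update hv]
    by_cases h : v.1 ∈ untouched f
    · rw [Finset.card_insert_of_notMem (notMem_usedColors_of_legalColor h hc)]
      have h₁ := card_openVertices_update_of_mem hv c h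
      have h₂ := Finset.card_erase_add_one h
      have h₃ := htwo v.1
      have h₄ := hne3 v.1
      rw [Nat.even_iff] at hparity
      rw [Nat.odd_iff]
      omega
    · rw [Finset.erase_eq_of_notMem h]
      have h₁ := card_openVertices_update_of_notMem hv c h
      have h₂ := Finset.card_le_card (Finset.subset_insert c (usedColors f))
      rw [Nat.even_iff] at hparity
      rw [Nat.odd_iff]
      omega
  generalize Function.update f v (some c) = g at hturn key
  obtain ⟨hg, hkey⟩ := key
  have hupos : 0 < (untouched g).card := by
    have h₂ := (usedColors g).card_le_univ
    rw [Fintype.card_fin] at h₂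
    omega
  refine ⟨hturn, hupos, fun hs => ?_⟩
  obtain ⟨d, hd⟩ := exists_notMem_usedColors hpos hupos hs
  rcases hkey with ⟨ha, hb⟩ | ⟨ha, hb⟩
  · obtain ⟨w, hw⟩ := Finset.card_pos.1 ha
    obtain ⟨hw₁, hw₂⟩ := Finset.mem_filter.1 hw
    rw [mem_uncolored] at hw₁
    have h₁ := card_openVertices_update_of_notMem hw₁ d hw₂
    refine ⟨_, ⟨w, d, hw₁, legalColor_of_notMem_usedColors hd w, rfl⟩,
      (aliceTurn_update hw₁ d).2 hturn, ?_, ?_⟩ <;>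
    rw [untouched_update, usedColors_update hw₁, Finset.card_insert_of_notMem hd,
      Finset.erase_eq_of_notMem hw₂]
    · omega
    · rw [Nat.odd_iff] at hb
      rw [Nat.even_iff]
      omega
  · obtain ⟨i, hi, hodd⟩ : ∃ i ∈ untouched g, Odd (r i) := by
      by_contra! h
      have h₁ : Even (∑ i ∈ untouched g, r i) :=
        Finset.even_sum _ fun i hi => Nat.not_odd_iff_even.1 (h i hi)
      have h₂ := card_uncolored_eq g
      have h₃ := card_colored_add_card_uncolored g
      unfold aliceTurn at hturn
      rw [Nat.even_iff] at *
      omega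
    have hw : g ⟨i, ⟨0, hpos i⟩⟩ = none := mem_untouched.1 hi _
    have h₁ := card_openVertices_update_of_mem hw d hi
    have h₂ := Finset.card_erase_add_one hi
    refine ⟨_, ⟨_, d, hw, legalColor_of_notMem_usedColors hd _, rfl⟩,
      (aliceTurn_update hw d).2 hturn, ?_, Or.inl ?_⟩
    · rw [untouched_update, usedColors_update hw, Finset.card_insert_of_notMem hd]
      dsimp only
      omega
    · rw [Nat.odd_iff] at hodd
      rw [Nat.even_iff]
      simp only at h₁
      omega

lemma BobInvariant.not_aliceWinsFrom (htwo : ∀ i, 2 ≤ r i) (hne3 : ∀ i, r i ≠ 3)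
    (heven : Even (∑ i, r i)) (N : ℕ) (f : Position k m r) (hf : BobInvariant f) :
    ¬ aliceWinsFrom (K k r) N f := by
  have hpos : ∀ i, 0 < r i := fun i => by have := htwo i; omega
  induction N using Nat.strong_induction_on generalizing f with
  | _ N ih =>
    have hfull := not_isFull_of_untouched hpos hf.untouched_pos
    match N with
    | 0 => exact hfull
    | N + 1 =>
      rintro (h | ⟨-, ⟨-, f', hmove, hwin⟩ | ⟨h, -⟩⟩)
      · exact hfull h
      · obtain ⟨hturn, hu, hreply⟩ := hf.reply htwo hne3 heven hmove
        have hfull' := not_isFull_of_untouched hpos hu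
        match N with
        | 0 => exact hfull' hwin
        | N + 1 =>
          obtain h | ⟨hs, ⟨h, -⟩ | ⟨-, h⟩⟩ := hwin
          · exact hfull' h
          · exact hturn h
          · obtain ⟨f'', hmove', hf''⟩ := hreply hs
            exact ih N (by omega) f'' hf'' (h f'' hmove')
      · exact h hf.turn

/-- Equal colors occur only within a part. -/
def IsProper (f : Position k m r) : Prop :=
  ∀ v w c, f v = some c → f w = some c → v.1 = w.1

lemma IsProper.move {f f' : Position k m r} (hf : IsProper f)
    (hmove : gameMove (K k r) f f') : IsProper f' := by
  obtain ⟨v, c, hv, hc, rfl⟩ := hmove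
  rw [legalColor_iff] at hc
  intro x y d hx hy
  rw [Function.update_apply] at hx hy
  split_ifs at hx hy with h₁ h₂ h₂
  · rw [h₁, h₂]
  · subst h₁
    cases hx
    by_contra h
    exact hc y h hy
  · subst h₂
    cases hy
    by_contra h
    exact hc x (Ne.symm h) hx
  · exact hf x y d hx hy

lemma IsProper.exists_legalColor {f : Position k m r} (hf : IsProper f)
    (h : untouched f = ∅ ∨ (usedColors f).card < m) (v : Σ i : Fin k, Fin (r i)) :
    ∃ c, legalColor (K k r) f v c := by
  by_cases hv : v.1 ∈ untouched f
  · have hlt : (usedColors f).card < m := h.resolve_left (Finset.ne_empty_of_mem hv)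
    obtain ⟨c, -, hc⟩ := Finset.exists_mem_notMem_of_card_lt_card
      (s := usedColors f) (t := Finset.univ) (by simpa using hlt)
    exact ⟨c, legalColor_of_notMem_usedColors hc v⟩
  · rw [mem_untouched, not_forall] at hv
    obtain ⟨x, hx⟩ := hv
    obtain ⟨c, hc⟩ := Option.ne_none_iff_exists'.1 hx
    refine ⟨c, legalColor_iff.2 fun w hw hwc => hw ?_⟩
    exact hf ⟨v.1, x⟩ w c hc hwc

/-- Alice wins from a position in which all parts are touched, or in which enough colors remain
for her to touch a new part on each of her moves. -/
lemma aliceWinsFrom_of_isProper (hpos : ∀ i, 0 < r i) (N : ℕ) (f : Position k m r)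
    (hN : (uncolored f).card = N) (hf : IsProper f)
    (ha : aliceTurn f → untouched f = ∅ ∨ 2 * (untouched f).card + (usedColors f).card ≤ m + 1)
    (hb : ¬ aliceTurn f → untouched f = ∅ ∨ 2 * (untouched f).card + (usedColors f).card ≤ m) :
    aliceWinsFrom (K k r) N f := by
  induction N generalizing f with
  | zero =>
    intro v
    have h : v ∉ uncolored f := by rw [Finset.card_eq_zero.1 hN]; simp
    rwa [mem_uncolored, ← ne_eq, Option.ne_none_iff_isSome] at h
  | succ N ih =>
    have hroom : untouched f = ∅ ∨ (usedColors f).card < m := by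
      by_cases h : untouched f = ∅
      · exact Or.inl h
      · have hu := Finset.card_pos.2 (Finset.nonempty_iff_ne_empty.2 h)
        by_cases ht : aliceTurn f
        · have := (ha ht).resolve_left h
          omega
        · have := (hb ht).resolve_left h
          omega
    refine Or.inr ⟨fun ⟨v, _, hs⟩ => ?_, ?_⟩
    · obtain ⟨c, hc⟩ := hf.exists_legalColor hroom v
      exact hs c hc
    by_cases ht : aliceTurn f
    · refine Or.inl ⟨ht, ?_⟩
      obtain ⟨v, hv, hvu⟩ : ∃ v, f v = none ∧ (untouched f = ∅ ∨ v.1 ∈ untouched f) := by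
        obtain h | ⟨i, hi⟩ := (untouched f).eq_empty_or_nonempty
        · obtain ⟨v, hv⟩ := Finset.card_pos.1 (show 0 < (uncolored f).card by omega)
          exact ⟨v, mem_uncolored.1 hv, Or.inl h⟩
        · exact ⟨⟨i, ⟨0, hpos i⟩⟩, mem_untouched.1 hi _, Or.inr hi⟩
      obtain ⟨c, hc⟩ := hf.exists_legalColor hroom v
      have hmove : gameMove (K k r) f (Function.update f v (some c)) := ⟨v, c, hv, hc, rfl⟩
      refine ⟨_, hmove, ih _ ?_ (hf.move hmove) ?_ fun _ => ?_⟩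
      · have := card_uncolored_update hv c
        omega
      · exact fun h => absurd ht ((aliceTurn_update hv c).1 h)
      · rw [untouched_update, usedColors_update hv]
        rcases hvu with h | h
        · simp [h]
        · refine Or.inr ?_
          have h₁ := (ha ht).resolve_left (Finset.ne_empty_of_mem h)
          have h₂ := Finset.card_erase_add_one h
          have h₃ := Finset.card_insert_le c (usedColors f)
          omega
    · refine Or.inr ⟨ht, fun f' hmove => ?_⟩
      have hf' := hf.move hmove
      obtain ⟨v, c, hv, hc, rfl⟩ := hmove
      refine ih _ ?_ hf' (fun _ => ?_) ?_
      · have := card_uncolored_update hv c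
        omega
      · rw [untouched_update, usedColors_update hv]
        rcases hb ht with h | h
        · simp [h]
        · refine Or.inr ?_
          have h₂ := Finset.card_le_card (Finset.erase_subset v.1 (untouched f))
          have h₃ := Finset.card_insert_le c (usedColors f)
          omega
      · exact fun h => absurd ((aliceTurn_update hv c).2 ht) h

lemma untouched_none : untouched (fun _ => none : Position k m r) = Finset.univ := by
  ext; simp

lemma usedColors_none : usedColors (fun _ => none : Position k m r) = ∅ := by
  ext; simp

lemma openVertices_none : openVertices (fun _ => none : Position k m r) = ∅ := by
  ext; simp [openVertices]

lemma aliceTurn_none : aliceTurn (fun _ => none : Position k m r) := by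
  simp [aliceTurn]

lemma aliceWins_of_two_mul_le (hpos : ∀ i, 0 < r i) (hm : 2 * k ≤ m + 1) :
    aliceWins (K k r) m := by
  refine aliceWinsFrom_of_isProper hpos _ _ ?_ (fun v w c h => by simp at h) (fun _ => Or.inr ?_)
    (fun h => absurd aliceTurn_none h)
  · simp [uncolored]
  · simpa [untouched_none, usedColors_none] using hm

lemma not_aliceWins_of_lt (htwo : ∀ i, 2 ≤ r i) (hne3 : ∀ i, r i ≠ 3)
    (heven : Even (∑ i, r i)) (hm : m + 2 ≤ 2 * k) : ¬ aliceWins (K k r) m := by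
  refine BobInvariant.not_aliceWinsFrom htwo hne3 heven _ _ ⟨aliceTurn_none, ?_, Or.inl ?_⟩
  · simpa [untouched_none, usedColors_none] using hm
  · simp [openVertices_none]

end MultipartiteGame

theorem game_chromatic_eq_of_min_two_no_three_even (k : ℕ) (hk : 3 ≤ k) (r : Fin k → ℕ)
    (hanti : Antitone r) (hlast : r ⟨k - 1, by omega⟩ = 2) (hne3 : ∀ j, r j ≠ 3)
    (heven : Even (∑ i, r i)) :
    gameChromaticNumber (K k r) = 2 * k - 1 := by
  have htwo : ∀ i, 2 ≤ r i := fun i => by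
    rw [← hlast]
    exact hanti (Fin.le_def.2 (by simp only; omega))
  have hmem : 2 * k - 1 ∈ {m | aliceWins (K k r) m} :=
    MultipartiteGame.aliceWins_of_two_mul_le (fun i => by have := htwo i; omega) (by omega)
  refine le_antisymm (Nat.sInf_le hmem) (le_csInf ⟨_, hmem⟩ fun m hm => ?_)
  by_contra! h
  exact MultipartiteGame.not_aliceWins_of_lt htwo hne3 heven (by omega) hm
end

section
/- Let K_{r_1,…,r_k} be a complete multipartite graph with k ≥ 3 parts whose smallest part has size r_k ≥ 4. Then the game chromatic number satisfies χ_g(K_{r_1,…,r_k}) = 2k − 1. -/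
section MultipartiteColoringGame

open Finset
open scoped Classical

variable {k : ℕ} {r : Fin k → ℕ} {C : Type}

/-- The parts of `K k r` without a colored vertex. -/
noncomputable def untouchedParts (f : (Σ i : Fin k, Fin (r i)) → Option C) : Finset (Fin k) :=
  univ.filter fun i => ∀ x, f ⟨i, x⟩ = none

/-- The colors not used so far. -/
noncomputable def freeColors [Fintype C] (f : (Σ i : Fin k, Fin (r i)) → Option C) : Finset C :=
  univ.filter fun c => ∀ v, f v ≠ some c

/-- The uncolored vertices lying in parts that already have a colored vertex. -/
noncomputable def touchedUncolored (f : (Σ i : Fin k, Fin (r i)) → Option C) :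
    Finset (Σ i : Fin k, Fin (r i)) :=
  univ.filter fun v => f v = none ∧ v.1 ∉ untouchedParts f

theorem mem_untouchedParts {f : (Σ i : Fin k, Fin (r i)) → Option C} {i : Fin k} :
    i ∈ untouchedParts f ↔ ∀ x, f ⟨i, x⟩ = none := by
  simp [untouchedParts]

theorem mem_freeColors [Fintype C] {f : (Σ i : Fin k, Fin (r i)) → Option C} {c : C} :
    c ∈ freeColors f ↔ ∀ v, f v ≠ some c := by
  simp [freeColors]

theorem mem_touchedUncolored {f : (Σ i : Fin k, Fin (r i)) → Option C}
    {v : Σ i : Fin k, Fin (r i)} :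
    v ∈ touchedUncolored f ↔ f v = none ∧ v.1 ∉ untouchedParts f := by
  simp [touchedUncolored]

theorem legalColor_K {f : (Σ i : Fin k, Fin (r i)) → Option C} {v : Σ i : Fin k, Fin (r i)}
    {c : C} : legalColor (K k r) f v c ↔ ∀ w, v.1 ≠ w.1 → f w ≠ some c :=
  Iff.rfl

theorem card_colored_update {V : Type} [Fintype V] [DecidableEq V] {f : V → Option C} {v : V}
    (hv : f v = none) (c : C) :
    (univ.filter fun w => (Function.update f v (some c) w).isSome = true).card
      = (univ.filter fun w => (f w).isSome = true).card + 1 := by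
  have h : (univ.filter fun w => (Function.update f v (some c) w).isSome = true)
      = insert v (univ.filter fun w => (f w).isSome = true) := by
    ext w
    by_cases hw : w = v
    · subst hw; simp
    · simp [hw]
  rw [h, card_insert_of_notMem (by simp [hv])]

theorem aliceTurn_of_gameMove {V : Type} [Fintype V] [DecidableEq V] {G : SimpleGraph V}
    {f f' : V → Option C} (h : gameMove G f f') : aliceTurn f' ↔ ¬ aliceTurn f := by
  obtain ⟨v, c, hv, -, rfl⟩ := h
  unfold aliceTurn
  rw [card_colored_update hv, Nat.even_add_one]

theorem untouchedParts_update (f : (Σ i : Fin k, Fin (r i)) → Option C)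
    (v : Σ i : Fin k, Fin (r i)) (c : C) :
    untouchedParts (Function.update f v (some c)) = (untouchedParts f).erase v.1 := by
  ext i
  rw [mem_erase, mem_untouchedParts, mem_untouchedParts]
  constructor
  · intro h
    have hi : i ≠ v.1 := by
      rintro rfl
      simpa using h v.2
    refine ⟨hi, fun x => ?_⟩
    have := h x
    rwa [Function.update_of_ne (fun e => hi (congrArg Sigma.fst e))] at this
  · rintro ⟨hi, h⟩ x
    rw [Function.update_of_ne (fun e => hi (congrArg Sigma.fst e))]
    exact h x

theorem freeColors_update [Fintype C] {f : (Σ i : Fin k, Fin (r i)) → Option C}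
    {v : Σ i : Fin k, Fin (r i)} (hv : f v = none) (c : C) :
    freeColors (Function.update f v (some c)) = (freeColors f).erase c := by
  ext d
  rw [mem_erase, mem_freeColors, mem_freeColors]
  constructor
  · intro h
    refine ⟨fun e => h v (by simp [e]), fun w => ?_⟩
    by_cases hw : w = v
    · subst hw; simp [hv]
    · simpa [hw] using h w
  · rintro ⟨hd, h⟩ w
    by_cases hw : w = v
    · subst hw; simpa using hd.symm
    · simpa [hw] using h w

theorem touchedUncolored_update_of_notMem {f : (Σ i : Fin k, Fin (r i)) → Option C}
    {v : Σ i : Fin k, Fin (r i)} (hu : v.1 ∉ untouchedParts f) (c : C) :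
    touchedUncolored (Function.update f v (some c)) = (touchedUncolored f).erase v := by
  ext w
  rw [mem_erase, mem_touchedUncolored, mem_touchedUncolored, untouchedParts_update,
    erase_eq_of_notMem hu]
  by_cases hw : w = v
  · subst hw; simp
  · simp [hw]

theorem card_touchedUncolored_update_of_mem {f : (Σ i : Fin k, Fin (r i)) → Option C}
    {v : Σ i : Fin k, Fin (r i)} (hu : v.1 ∈ untouchedParts f) (c : C) :
    (touchedUncolored (Function.update f v (some c))).card + 1
      = (touchedUncolored f).card + r v.1 := by
  obtain ⟨i, x⟩ := v
  have h : touchedUncolored (Function.update f ⟨i, x⟩ (some c))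
      = touchedUncolored f ∪ (univ.erase x).map (Function.Embedding.sigmaMk i) := by
    ext ⟨j, y⟩
    rw [mem_union, mem_touchedUncolored, mem_touchedUncolored, untouchedParts_update]
    by_cases hj : j = i
    · subst hj
      have hy := mem_untouchedParts.1 hu y
      by_cases hyx : y = x
      · subst hyx; simp [hu]
      · simp [hu, hyx, hy]
    · have hne : ¬ ((⟨j, y⟩ : Σ i : Fin k, Fin (r i)) = ⟨i, x⟩) :=
        fun e => hj (congrArg Sigma.fst e)
      have hij : ¬ i = j := fun e => hj e.symm
      simp [hne, hj, hij]
  have hd : Disjoint (touchedUncolored f)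
      ((univ.erase x).map (Function.Embedding.sigmaMk (β := fun i => Fin (r i)) i)) := by
    rw [disjoint_left]
    intro w hw hw'
    obtain ⟨y, -, rfl⟩ := mem_map.1 hw'
    exact (mem_touchedUncolored.1 hw).2 hu
  have hx : 0 < r i := x.pos
  rw [h, card_union_of_disjoint hd, card_map, card_erase_of_mem (mem_univ x), card_univ,
    Fintype.card_fin]
  dsimp only
  omega

theorem gameMove_K_cases [Fintype C] {f f' : (Σ i : Fin k, Fin (r i)) → Option C}
    (h : gameMove (K k r) f f') :
    (∃ i, (untouchedParts f').card + 1 = (untouchedParts f).card ∧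
      (freeColors f').card + 1 = (freeColors f).card ∧
      (touchedUncolored f').card + 1 = (touchedUncolored f).card + r i) ∨
    (untouchedParts f').card = (untouchedParts f).card ∧
      ((freeColors f').card + 1 = (freeColors f).card ∨
        (freeColors f').card = (freeColors f).card) ∧
      (touchedUncolored f').card + 1 = (touchedUncolored f).card := by
  obtain ⟨v, c, hv, hc, rfl⟩ := h
  rw [legalColor_K] at hc
  rw [untouchedParts_update, freeColors_update hv]
  by_cases hu : v.1 ∈ untouchedParts f
  · have hfree : c ∈ freeColors f := by
      rw [mem_freeColors]
      intro w
      by_cases hw : v.1 = w.1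
      · obtain ⟨j, y⟩ := w
        have := mem_untouchedParts.1 hu
        dsimp only at hw
        subst hw
        simp [this]
      · exact hc w hw
    exact Or.inl ⟨v.1, card_erase_add_one hu, card_erase_add_one hfree,
      card_touchedUncolored_update_of_mem hu c⟩
  · right
    rw [touchedUncolored_update_of_notMem hu, erase_eq_of_notMem hu]
    refine ⟨rfl, ?_, card_erase_add_one (mem_touchedUncolored.2 ⟨hv, hu⟩)⟩
    by_cases hfree : c ∈ freeColors f
    · exact Or.inl (card_erase_add_one hfree)
    · exact Or.inr (by rw [erase_eq_of_notMem hfree])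

theorem exists_gameMove_touch [Fintype C] (hr : ∀ i, 0 < r i)
    {f : (Σ i : Fin k, Fin (r i)) → Option C}
    (hU : 0 < (untouchedParts f).card) (hF : 0 < (freeColors f).card) :
    ∃ f' i, gameMove (K k r) f f' ∧ (untouchedParts f').card + 1 = (untouchedParts f).card ∧
      (freeColors f').card + 1 = (freeColors f).card ∧
      (touchedUncolored f').card + 1 = (touchedUncolored f).card + r i := by
  obtain ⟨i, hi⟩ := card_pos.1 hU
  obtain ⟨c, hc⟩ := card_pos.1 hF
  let v : Σ i : Fin k, Fin (r i) := ⟨i, ⟨0, hr i⟩⟩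
  have hv : f v = none := mem_untouchedParts.1 hi _
  refine ⟨Function.update f v (some c), i,
    ⟨v, c, hv, fun w _ => mem_freeColors.1 hc w, rfl⟩, ?_, ?_,
    card_touchedUncolored_update_of_mem (v := v) hi c⟩
  · rw [untouchedParts_update]
    exact card_erase_add_one hi
  · rw [freeColors_update hv]
    exact card_erase_add_one hc

theorem exists_gameMove_waste [Fintype C] {f : (Σ i : Fin k, Fin (r i)) → Option C}
    (hT : 0 < (touchedUncolored f).card) (hF : 0 < (freeColors f).card) :
    ∃ f', gameMove (K k r) f f' ∧ (untouchedParts f').card = (untouchedParts f).card ∧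
      (freeColors f').card + 1 = (freeColors f).card ∧
      (touchedUncolored f').card + 1 = (touchedUncolored f).card := by
  obtain ⟨v, hv⟩ := card_pos.1 hT
  obtain ⟨c, hc⟩ := card_pos.1 hF
  obtain ⟨hn, hu⟩ := mem_touchedUncolored.1 hv
  refine ⟨Function.update f v (some c),
    ⟨v, c, hn, fun w _ => mem_freeColors.1 hc w, rfl⟩, ?_, ?_, ?_⟩
  · rw [untouchedParts_update, erase_eq_of_notMem hu]
  · rw [freeColors_update hn]
    exact card_erase_add_one hc
  · rw [touchedUncolored_update_of_notMem hu]
    exact card_erase_add_one hv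

/-- Adjacent vertices never carry the same color in the partial coloring `f`. -/
def IsProperPartial {V : Type} (G : SimpleGraph V) (f : V → Option C) : Prop :=
  ∀ v w c, G.Adj v w → f v = some c → f w ≠ some c

theorem IsProperPartial.of_gameMove {V : Type} [DecidableEq V] {G : SimpleGraph V}
    {f f' : V → Option C} (hf : IsProperPartial G f) (h : gameMove G f f') :
    IsProperPartial G f' := by
  obtain ⟨v, c, hv, hc, rfl⟩ := h
  intro a b d hab ha hb
  by_cases hav : a = v
  · subst hav
    have hba : b ≠ a := hab.ne'
    simp only [Function.update_self, Option.some.injEq] at ha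
    subst ha
    rw [Function.update_of_ne hba] at hb
    exact hc b hab hb
  · rw [Function.update_of_ne hav] at ha
    by_cases hbv : b = v
    · subst hbv
      simp only [Function.update_self, Option.some.injEq] at hb
      subst hb
      exact hc a hab.symm ha
    · rw [Function.update_of_ne hbv] at hb
      exact hf a b d hab ha hb

theorem IsProperPartial.exists_legalColor {f : (Σ i : Fin k, Fin (r i)) → Option C}
    (hf : IsProperPartial (K k r) f) {v : Σ i : Fin k, Fin (r i)} (hu : v.1 ∉ untouchedParts f) :
    ∃ c, legalColor (K k r) f v c := by
  rw [mem_untouchedParts] at hu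
  push Not at hu
  obtain ⟨x, hx⟩ := hu
  obtain ⟨c, hc⟩ := Option.ne_none_iff_exists'.1 hx
  exact ⟨c, legalColor_K.2 fun w hw => hf ⟨v.1, x⟩ w c hw hc⟩

theorem isStuck_K [Fintype C] (hr : ∀ i, 0 < r i) {f : (Σ i : Fin k, Fin (r i)) → Option C}
    (hU : 0 < (untouchedParts f).card) (hF : (freeColors f).card = 0) : isStuck (K k r) f := by
  obtain ⟨i, hi⟩ := card_pos.1 hU
  rw [mem_untouchedParts] at hi
  refine ⟨⟨i, ⟨0, hr i⟩⟩, hi _, fun c hc => ?_⟩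
  have hcf : c ∈ freeColors f := by
    rw [mem_freeColors]
    rintro ⟨j, y⟩
    by_cases hj : i = j
    · subst hj; simp [hi]
    · exact legalColor_K.1 hc ⟨j, y⟩ hj
  rw [card_eq_zero] at hF
  simp [hF] at hcf

theorem not_isFull_K (hr : ∀ i, 0 < r i) {f : (Σ i : Fin k, Fin (r i)) → Option C}
    (hU : 0 < (untouchedParts f).card) : ¬ isFull f := by
  obtain ⟨i, hi⟩ := card_pos.1 hU
  intro h
  simpa [mem_untouchedParts.1 hi] using h ⟨i, ⟨0, hr i⟩⟩

/-- Bob wins from a position on Alice's turn if there are few free colors. -/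
theorem not_aliceWinsFrom_K [Fintype C] (hr : ∀ i, 4 ≤ r i) (n : ℕ)
    (f : (Σ i : Fin k, Fin (r i)) → Option C) (hturn : aliceTurn f)
    (hF : (freeColors f).card + 2 ≤ 2 * (untouchedParts f).card)
    (hT : (touchedUncolored f).card = 1 →
      (freeColors f).card + 3 ≤ 2 * (untouchedParts f).card) :
    ¬ aliceWinsFrom (K k r) n f := by
  have hr0 : ∀ i, 0 < r i := fun i => by have := hr i; omega
  induction n using Nat.strong_induction_on generalizing f with
  | _ n ih =>
  have hfull := not_isFull_K hr0 (f := f) (by omega)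
  match n with
  | 0 => exact hfull
  | n + 1 =>
    rintro (h | ⟨hst, ⟨-, f', hmove, hwin⟩ | ⟨h, -⟩⟩)
    · exact hfull h
    · have hF0 : (freeColors f).card ≠ 0 := fun h => hst (isStuck_K hr0 (by omega) h)
      have hcases := gameMove_K_cases hmove
      have hU' : 0 < (untouchedParts f').card := by omega
      have hturn' : ¬ aliceTurn f' := fun h => (aliceTurn_of_gameMove hmove).1 h hturn
      have hfull' := not_isFull_K hr0 hU'
      match n, hwin with
      | 0, hwin => exact hfull' hwin
      | n + 1, hwin =>
        rcases hwin with h | ⟨hst', ⟨h, -⟩ | ⟨-, hall⟩⟩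
        · exact hfull' h
        · exact hturn' h
        · have hF' : (freeColors f').card ≠ 0 := fun h => hst' (isStuck_K hr0 hU' h)
          by_cases hT' : (touchedUncolored f').card = 0
          · obtain ⟨f'', i, hm, hu, hf, ht⟩ :=
              exists_gameMove_touch hr0 hU' (Nat.pos_of_ne_zero hF')
            have hri := hr i
            have hcases' : (untouchedParts f').card = (untouchedParts f).card ∧
                (freeColors f').card ≤ (freeColors f).card ∧
                (touchedUncolored f).card = 1 := by
              rcases hcases with ⟨j, -, -, hj⟩ | ⟨h1, h2, h3⟩
              · have := hr j
                omega
              · omega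
            have := hT hcases'.2.2
            exact ih n (by omega) f'' ((aliceTurn_of_gameMove hm).2 hturn') (by omega)
              (by omega) (hall f'' hm)
          · obtain ⟨f'', hm, hu, hf, ht⟩ :=
              exists_gameMove_waste (Nat.pos_of_ne_zero hT') (Nat.pos_of_ne_zero hF')
            refine ih n (by omega) f'' ((aliceTurn_of_gameMove hm).2 hturn') ?_ ?_ (hall f'' hm)
            · omega
            · rcases hcases with ⟨j, -, -, hj⟩ | ⟨h1, h2, h3⟩
              · have := hr j
                omega
              · omega
    · exact h hturn

/-- Alice wins from positions with enough free colors. -/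
theorem aliceWinsFrom_K [Fintype C] (hr : ∀ i, 0 < r i) (n : ℕ)
    (f : (Σ i : Fin k, Fin (r i)) → Option C) (hf : IsProperPartial (K k r) f)
    (hn : (univ.filter fun v => (f v).isSome = true).card + n
      = Fintype.card (Σ i : Fin k, Fin (r i)))
    (hF : 2 * (untouchedParts f).card ≤ (freeColors f).card + 1)
    (hB : ¬ aliceTurn f → 2 * (untouchedParts f).card ≤ (freeColors f).card) :
    aliceWinsFrom (K k r) n f := by
  induction n generalizing f with
  | zero =>
    intro v
    have h := (card_eq_iff_eq_univ _).1 hn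
    have hv : v ∈ univ.filter fun v => (f v).isSome = true := by rw [h]; exact mem_univ v
    exact (mem_filter.1 hv).2
  | succ n ih =>
    have hn' : ∀ f', gameMove (K k r) f f' →
        (univ.filter fun v => (f' v).isSome = true).card + n
          = Fintype.card (Σ i : Fin k, Fin (r i)) := by
      rintro f' ⟨v, c, hv, -, rfl⟩
      rw [card_colored_update hv]
      omega
    refine or_iff_not_imp_left.2 fun hfull => ⟨?_, ?_⟩
    · rintro ⟨v, -, hc⟩
      by_cases hu : v.1 ∈ untouchedParts f
      · have hU := card_pos.2 ⟨_, hu⟩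
        obtain ⟨c, hcf⟩ := card_pos.1 (show 0 < (freeColors f).card by omega)
        exact hc c fun w _ => mem_freeColors.1 hcf w
      · obtain ⟨c, hl⟩ := hf.exists_legalColor hu
        exact hc c hl
    · by_cases hturn : aliceTurn f
      · refine Or.inl ⟨hturn, ?_⟩
        by_cases hU : (untouchedParts f).card = 0
        · obtain ⟨v, hv⟩ : ∃ v, f v = none := by
            simpa [isFull] using hfull
          have hu : v.1 ∉ untouchedParts f := by
            rw [card_eq_zero] at hU
            simp [hU]
          obtain ⟨c, hl⟩ := hf.exists_legalColor hu
          have hm : gameMove (K k r) f (Function.update f v (some c)) := ⟨v, c, hv, hl, rfl⟩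
          have hU' : (untouchedParts (Function.update f v (some c))).card = 0 := by
            rw [untouchedParts_update, erase_eq_of_notMem hu, hU]
          exact ⟨_, hm, ih _ (hf.of_gameMove hm) (hn' _ hm) (by omega) (by omega)⟩
        · obtain ⟨f', i, hm, h1, h2, -⟩ :=
            exists_gameMove_touch hr (f := f) (by omega) (by omega)
          exact ⟨f', hm, ih f' (hf.of_gameMove hm) (hn' f' hm) (by omega) (by omega)⟩
      · refine Or.inr ⟨hturn, fun f' hm => ?_⟩
        have := hB hturn
        have hcases := gameMove_K_cases hm
        exact ih f' (hf.of_gameMove hm) (hn' f' hm) (by omega)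
          fun h => absurd ((aliceTurn_of_gameMove hm).2 hturn) h

theorem aliceWins_K_iff (hr : ∀ i, 4 ≤ r i) (m : ℕ) : aliceWins (K k r) m ↔ 2 * k ≤ m + 1 := by
  have hU : untouchedParts (fun _ : Σ i : Fin k, Fin (r i) => (none : Option (Fin m))) = univ := by
    ext; simp [mem_untouchedParts]
  have hF : freeColors (fun _ : Σ i : Fin k, Fin (r i) => (none : Option (Fin m))) = univ := by
    ext; simp [mem_freeColors]
  have hT : touchedUncolored (fun _ : Σ i : Fin k, Fin (r i) => (none : Option (Fin m))) = ∅ := by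
    ext; simp [mem_touchedUncolored, hU]
  have hturn : aliceTurn (fun _ : Σ i : Fin k, Fin (r i) => (none : Option (Fin m))) := by
    simp [aliceTurn]
  constructor
  · intro h
    by_contra hm
    refine not_aliceWinsFrom_K hr _ _ hturn ?_ ?_ h
    · simp only [hU, hF, card_univ, Fintype.card_fin]
      omega
    · simp [hT]
  · intro hm
    refine aliceWinsFrom_K (fun i => by have := hr i; omega) _ _ ?_ ?_ ?_ (absurd hturn)
    · intro v w c _ hv
      simp at hv
    · simp
    · simpa [hU, hF] using hm

end MultipartiteColoringGame

theorem game_chromatic_eq_of_min_ge_four (k : ℕ) (hk : 3 ≤ k) (r : Fin k → ℕ)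
    (hanti : Antitone r) (hlast : 4 ≤ r ⟨k - 1, by omega⟩) :
    gameChromaticNumber (K k r) = 2 * k - 1 := by
  have hr : ∀ i, 4 ≤ r i := fun i =>
    hlast.trans (hanti (Fin.le_def.2 (by have := i.2; dsimp only; omega)))
  have hset : {m | aliceWins (K k r) m} = Set.Ici (2 * k - 1) := by
    ext m
    rw [Set.mem_ofPred_eq, aliceWins_K_iff hr, Set.mem_Ici]
    omega
  rw [gameChromaticNumber, hset, csInf_Ici]
end
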